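/- Assume n ≡ m ≡ 1 (mod 2) with (n,m) ≠ (1,1), let μ ∈ X⁺₀(n) and ν ∈ X⁺₀(m) correspond to (w,l) ∈ L⁺₀(n) and (w',l') ∈ L⁺₀(m) with l₁ > l'₁ and l_i ≠ l'_j for all (i,j) ≠ ((n+1)/2,(m+1)/2), let a be the position tuple with k jump indices, λ_j := ν_j + a_j − j, κ := (w+w'+1)/2 and L := (1/2)·min{|l_i − l'_j| : (i,j) ≠ ((n+1)/2,(m+1)/2)}. Then t ∈ (m+n)/2 + ℤ satisfies |t − κ| < L + 1/2 if and only if the integer s := t + (n−m)/2 − 1 satisfies μ̌_{a_j} ≥ λ_j − s ≥ μ̌_{1+a_j} for all j ≠ (m+1)/2 together with the middle condition: μ̌_{(n−1)/2} ≥ λ_{(m+1)/2} − s ≥ μ̌_{(n+3)/2} − 1 if k is even, respectively λ_{(m−1)/2} ≥ μ̌_{(n+1)/2} + s ≥ λ_{(m+3)/2} if k is odd. Here μ̌_i := −μ_{n+1−i}. -/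

import Mathlib

/-- `(w, l) ∈ L⁺₀(n)`. -/
def IsLanglandsParam (n : ℕ) (w : ℤ) (l : ℕ → ℤ) : Prop :=
  (∀ i, 1 ≤ i → i < n → l (i + 1) < l i) ∧
  (∀ i, 1 ≤ i → i ≤ n → l i + l (n + 1 - i) = 0) ∧
  (∀ i, 1 ≤ i → i ≤ n → (w + l i) % 2 = ((n : ℤ) + 1) % 2)

/-- `μ` is dominant with purity weight `W`. -/
def IsDominantPure (n : ℕ) (μ : ℕ → ℤ) (W : ℤ) : Prop :=
  (∀ i, 1 ≤ i → i < n → μ (i + 1) ≤ μ i) ∧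
  (∀ i, 1 ≤ i → i ≤ n → μ i + μ (n + 1 - i) = W)

/-- The weight `μ ∈ X⁺₀(n)` corresponds to `(w, l) ∈ L⁺₀(n)`. -/
def Corresponds (n : ℕ) (w : ℤ) (l : ℕ → ℤ) (μ : ℕ → ℤ) : Prop :=
  w = μ 1 + μ n ∧
  ∀ i, 1 ≤ i → i ≤ n → l i = 2 * μ i + (n : ℤ) + 1 - w - 2 * (i : ℤ)

/-- `a` is the position tuple. -/
def IsPositionTuple (n m : ℕ) (l l' : ℕ → ℤ) (a : ℕ → ℕ) : Prop :=
  ∀ j, 1 ≤ j → j ≤ m →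
    1 ≤ a j ∧ a j ≤ n - 1 ∧ l' j < l (a j) ∧ l (1 + a j) ≤ l' j

theorem anti_aux (n : ℕ) (l : ℕ → ℤ) (h : ∀ i, 1 ≤ i → i < n → l (i + 1) < l i) :
    ∀ d i, 1 ≤ i → i + d ≤ n → l (i + d) + d ≤ l i := by
  intro d
  induction d with
  | zero => intro i _ _; simp
  | succ d ih =>
    intro i h1 h2
    have := ih i h1 (by omega)
    have h3 := h (i + d) (by omega) (by omega)
    rw [← add_assoc]
    push_cast
    linarith

theorem anti_aux' (n : ℕ) (l : ℕ → ℤ) (h : ∀ i, 1 ≤ i → i < n → l (i + 1) < l i)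
    (i j : ℕ) (hi : 1 ≤ i) (hij : i < j) (hj : j ≤ n) : l j < l i := by
  have := anti_aux n l h (j - i) i hi (by omega)
  rw [show i + (j - i) = j by omega] at this
  omega

theorem even_aux (M : ℕ) (P : ℕ → Prop) [DecidablePred P] (hM : Odd M)
    (h : ∀ j, 1 ≤ j → j ≤ M - 1 → P j → P (M - j)) :
    Even ((Finset.Icc 1 (M - 1)).filter P).card := by
  have : ∑ j ∈ (Finset.Icc 1 (M - 1)).filter P, (1 : ZMod 2) = 0 := by
    apply Finset.sum_involution (fun j _ => M - j)
    · intro j hj; decide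
    · intro j hj _
      simp only [Finset.mem_filter, Finset.mem_Icc] at hj
      obtain ⟨r, rfl⟩ := hM
      omega
    · intro j hj
      simp only [Finset.mem_filter, Finset.mem_Icc] at hj ⊢
      exact ⟨by omega, h j hj.1.1 hj.1.2 hj.2⟩
    · intro j hj
      simp only [Finset.mem_filter, Finset.mem_Icc] at hj
      omega
  rw [Finset.sum_const, nsmul_eq_mul, mul_one] at this
  exact (ZMod.natCast_eq_zero_iff_even).1 this

set_option maxHeartbeats 2000000 in
theorem critical_iff_inequalities_exceptional
    (n m : ℕ) (hn : 1 ≤ n) (hm : 1 ≤ m) (hno : Odd n) (hmo : Odd m)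
    (hnm : ¬(n = 1 ∧ m = 1))
    (w w' : ℤ) (l l' : ℕ → ℤ) (μ ν : ℕ → ℤ)
    (hl : IsLanglandsParam n w l) (hl' : IsLanglandsParam m w' l')
    (hμ : IsDominantPure n μ w) (hν : IsDominantPure m ν w')
    (hcorr : Corresponds n w l μ) (hcorr' : Corresponds m w' l' ν)
    (hfirst : l' 1 < l 1)
    (hdisj : ∀ i ∈ Finset.Icc 1 n, ∀ j ∈ Finset.Icc 1 m,
      (i, j) ≠ ((n + 1) / 2, (m + 1) / 2) → l i ≠ l' j)
    (a : ℕ → ℕ) (ha : IsPositionTuple n m l l' a)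
    -- `k` is the number of jump indices of `a`
    (k : ℕ) (hk : k = ((Finset.Icc 1 (m - 1)).filter (fun j => a j < a (j + 1))).card)
    (lam : ℕ → ℤ) (hlam : ∀ j, lam j = ν j + (a j : ℤ) - (j : ℤ))
    (μd : ℕ → ℤ) (hμd : ∀ i, μd i = - μ (n + 1 - i))
    (κ L : ℚ) (hκ : κ = ((w : ℚ) + w' + 1) / 2)
    -- `L` is half the minimum of `|l_i - l'_j|` over pairs `(i,j) ≠ ((n+1)/2, (m+1)/2)`:
    (hLlb : ∀ i ∈ Finset.Icc 1 n, ∀ j ∈ Finset.Icc 1 m,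
      (i, j) ≠ ((n + 1) / 2, (m + 1) / 2) → L ≤ (|l i - l' j| : ℚ) / 2)
    (hLmem : ∃ i ∈ Finset.Icc 1 n, ∃ j ∈ Finset.Icc 1 m,
      (i, j) ≠ ((n + 1) / 2, (m + 1) / 2) ∧ L = (|l i - l' j| : ℚ) / 2)
    (t : ℚ) (ht : ∃ z : ℤ, t = ((m : ℚ) + n) / 2 + z)
    (s : ℤ) (hs : (s : ℚ) = t + ((n : ℚ) - m) / 2 - 1) :
    |t - κ| < L + 1 / 2 ↔
      ((∀ j, 1 ≤ j → j ≤ m → j ≠ (m + 1) / 2 →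
          lam j - s ≤ μd (a j) ∧ μd (1 + a j) ≤ lam j - s) ∧
       (Even k →
          lam ((m + 1) / 2) - s ≤ μd ((n - 1) / 2) ∧
          μd ((n + 3) / 2) - 1 ≤ lam ((m + 1) / 2) - s) ∧
       (Odd k →
          μd ((n + 1) / 2) + s ≤ lam ((m - 1) / 2) ∧
          lam ((m + 3) / 2) ≤ μd ((n + 1) / 2) + s)) := by
  obtain ⟨p, rfl⟩ := hno
  obtain ⟨q, rfl⟩ := hmo
  have e1 : (2 * p + 1 + 1) / 2 = p + 1 := by omega
  have e2 : (2 * q + 1 + 1) / 2 = q + 1 := by omega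
  have e3 : (2 * p + 1 - 1) / 2 = p := by omega
  have e4 : (2 * p + 1 + 3) / 2 = p + 2 := by omega
  have e5 : (2 * q + 1 - 1) / 2 = q := by omega
  have e6 : (2 * q + 1 + 3) / 2 = q + 2 := by omega
  simp only [e1, e2, e3, e4, e5, e6] at *
  obtain ⟨hl1, hl2, hl3⟩ := hl
  obtain ⟨hl1', hl2', hl3'⟩ := hl'
  obtain ⟨-, hμ2⟩ := hμ
  obtain ⟨-, hc⟩ := hcorr
  obtain ⟨-, hc'⟩ := hcorr'
  have hA := anti_aux' _ l hl1
  have hA' := anti_aux' _ l' hl1'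
  have l0 : l (p + 1) = 0 := by
    have := hl2 (p + 1) (by omega) (by omega)
    rw [show 2 * p + 1 + 1 - (p + 1) = p + 1 by omega] at this
    omega
  have l0' : l' (q + 1) = 0 := by
    have := hl2' (q + 1) (by omega) (by omega)
    rw [show 2 * q + 1 + 1 - (q + 1) = q + 1 by omega] at this
    omega
  have hw : w % 2 = 0 := by
    have := hl3 (p + 1) (by omega) (by omega)
    rw [l0] at this
    push_cast at this
    omega
  have hw' : w' % 2 = 0 := by
    have := hl3' (q + 1) (by omega) (by omega)
    rw [l0'] at this
    push_cast at this
    omega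
  have hle : ∀ i, 1 ≤ i → i ≤ 2 * p + 1 → l i % 2 = 0 := by
    intro i h1 h2
    have := hl3 i h1 h2
    push_cast at this
    omega
  have hle' : ∀ i, 1 ≤ i → i ≤ 2 * q + 1 → l' i % 2 = 0 := by
    intro i h1 h2
    have := hl3' i h1 h2
    push_cast at this
    omega
  have hp : 1 ≤ p := by
    have := ha 1 (by omega) (by omega)
    omega
  -- position facts
  have hpos1 : ∀ i j, 1 ≤ j → j ≤ 2 * q + 1 → 1 ≤ i → i ≤ 2 * p + 1 → l' j < l i → i ≤ a j := by
    intro i j h1 h2 h3 h4 h5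
    obtain ⟨b1, b2, b3, b4⟩ := ha j h1 h2
    by_contra hcon
    rcases Nat.lt_or_ge (1 + a j) i with h | h
    · have := hA (1 + a j) i (by omega) h h4
      omega
    · have : i = 1 + a j := by omega
      subst this
      omega
  have hpos2 : ∀ i j, 1 ≤ j → j ≤ 2 * q + 1 → 1 ≤ i → i ≤ 2 * p + 1 → l i ≤ l' j →
      1 + a j ≤ i := by
    intro i j h1 h2 h3 h4 h5
    obtain ⟨b1, b2, b3, b4⟩ := ha j h1 h2
    by_contra hcon
    rcases Nat.lt_or_ge i (a j) with h | h
    · have := hA i (a j) (by omega) h (by omega)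
      omega
    · have : i = a j := by omega
      subst this
      omega
  have hmid : a (q + 1) = p := by
    have h1 := hpos1 p (q + 1) (by omega) (by omega) hp (by omega)
      (by rw [l0', ← l0]; exact hl1 p hp (by omega))
    have h2 := hpos2 (p + 1) (q + 1) (by omega) (by omega) (by omega) (by omega)
      (by rw [l0', ← l0])
    omega
  have hdis : ∀ i j, 1 ≤ i → i ≤ 2 * p + 1 → 1 ≤ j → j ≤ 2 * q + 1 → j ≠ q + 1 →
      l i ≠ l' j := by
    intro i j h1 h2 h3 h4 h5
    apply hdisj i (by simp; omega) j (by simp; omega)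
    simp [h5]
  have hmir : ∀ j, 1 ≤ j → j ≤ 2 * q + 1 → j ≠ q + 1 →
      a (2 * q + 2 - j) = 2 * p + 1 - a j := by
    intro j h1 h2 h3
    obtain ⟨b1, b2, b3, b4⟩ := ha j h1 h2
    have c1 := hl2 (a j) (by omega) (by omega)
    have c2 := hl2 (1 + a j) (by omega) (by omega)
    have c3 := hl2' j h1 h2
    have c4 := hdis (1 + a j) j (by omega) (by omega) h1 h2 h3
    have f1 : 2 * p + 1 + 1 - (1 + a j) = 2 * p + 1 - a j := by omega
    rw [f1] at c2
    rw [show 2 * q + 1 + 1 - j = 2 * q + 2 - j by omega] at c3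
    have d1 := hpos1 (2 * p + 1 - a j) (2 * q + 2 - j) (by omega) (by omega) (by omega)
      (by omega) (by omega)
    have d2 := hpos2 (2 * p + 1 + 1 - a j) (2 * q + 2 - j) (by omega) (by omega) (by omega)
      (by omega) (by omega)
    omega
  have hodd : Odd k → 1 ≤ q ∧ a q = p := by
    intro hko
    have hq : 1 ≤ q := by
      by_contra hq
      have : q = 0 := by omega
      subst this
      simp at hk
      subst hk
      simp at hko
    refine ⟨hq, ?_⟩
    have hqle : a q ≤ p := by
      have h2 := hpos2 (p + 1) q (by omega) (by omega) (by omega) (by omega)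
        (by rw [l0, ← l0']; exact (hl1' q hq (by omega)).le)
      omega
    by_contra hne
    have hev : Even k := by
      rw [hk]
      apply even_aux (2 * q + 1) (fun j => a j < a (j + 1)) ⟨q, rfl⟩
      intro j h1 h2 h3
      have hm2 := hmir q hq (by omega) (by omega)
      rw [show 2 * q + 2 - q = q + 2 by omega] at hm2
      by_cases hj : j = q
      · subst hj
        have : 2 * j + 1 - j = j + 1 := by omega
        simp only [this]
        rw [hmid, show j + 1 + 1 = j + 2 by omega]
        omega
      by_cases hj' : j = q + 1
      · subst hj'
        have : 2 * q + 1 - (q + 1) = q := by omega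
        simp only [this]
        omega
      have g1 := hmir j h1 (by omega) hj'
      have g2 := hmir (j + 1) (by omega) (by omega) (by omega)
      have g3 : 2 * q + 1 - j + 1 = 2 * q + 2 - j := by omega
      have g4 : 2 * q + 2 - (j + 1) = 2 * q + 1 - j := by omega
      rw [g4] at g2
      simp only [g3]
      rw [g1, g2]
      have := (ha (j + 1) (by omega) (by omega)).2.1
      omega
    exact (Nat.not_even_iff_odd.2 hko) hev
  obtain ⟨T, hT⟩ : ∃ T : ℤ, T = 2 * (s - p + q) - (w + w') := ⟨_, rfl⟩
  have hTe : T % 2 = 0 := by omega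
  have htk : t - κ = ((T : ℚ) + 1) / 2 := by
    rw [hT, hκ]
    push_cast at hs ⊢
    linarith
  have key : |t - κ| < L + 1 / 2 ↔ ∀ i j, 1 ≤ i → i ≤ 2 * p + 1 → 1 ≤ j → j ≤ 2 * q + 1 →
      ¬ (i = p + 1 ∧ j = q + 1) → -|l i - l' j| ≤ T ∧ T ≤ |l i - l' j| - 2 := by
    have base : ∀ D : ℤ, D % 2 = 0 → (|t - κ| < (D : ℚ) / 2 + 1 / 2 ↔ -D ≤ T ∧ T ≤ D - 2) := by
      intro D hD
      rw [htk, abs_lt]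
      constructor
      · rintro ⟨h1, h2⟩
        have h3 : -D - 2 < T := by
          have : ((-D - 2 : ℤ) : ℚ) < T := by push_cast; linarith
          exact_mod_cast this
        have h4 : T < D := by
          have : (T : ℚ) < D := by linarith
          exact_mod_cast this
        omega
      · rintro ⟨h1, h2⟩
        have h3 : ((-D : ℤ) : ℚ) ≤ T := by exact_mod_cast h1
        have h4 : (T : ℚ) ≤ ((D - 2 : ℤ) : ℚ) := by exact_mod_cast h2
        push_cast at h3 h4
        constructor <;> linarith
    have hev : ∀ i j, 1 ≤ i → i ≤ 2 * p + 1 → 1 ≤ j → j ≤ 2 * q + 1 →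
        |l i - l' j| % 2 = 0 := by
      intro i j h1 h2 h3 h4
      have := hle i h1 h2
      have := hle' j h3 h4
      rcases abs_cases (l i - l' j) with h | h <;> omega
    constructor
    · intro h i j h1 h2 h3 h4 h5
      have := hLlb i (by simp; omega) j (by simp; omega) (by simpa using h5)
      apply (base _ (hev i j h1 h2 h3 h4)).1
      push_cast
      linarith
    · intro h
      obtain ⟨i, hi, j, hj, hij, hL⟩ := hLmem
      rw [Finset.mem_Icc] at hi hj
      have h1 := h i j hi.1 hi.2 hj.1 hj.2 (by simpa using hij)
      have h2 := (base _ (hev i j hi.1 hi.2 hj.1 hj.2)).2 h1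
      push_cast at h2
      rw [hL]
      exact h2
  rw [key]
  have hμd' : ∀ i, 1 ≤ i → i ≤ 2 * p + 1 → 2 * μd i = l i - 2 * p - 2 - w + 2 * i := by
    intro i h1 h2
    have c1 := hμd i
    have c2 := hμ2 i h1 h2
    have c3 := hc i h1 h2
    push_cast at c3
    omega
  have hlam' : ∀ j, 1 ≤ j → j ≤ 2 * q + 1 →
      2 * lam j = l' j - 2 * q - 2 + w' + 2 * a j := by
    intro j h1 h2
    have c1 := hlam j
    have c3 := hc' j h1 h2
    push_cast at c3
    omega
  have ineq1 : ∀ j, 1 ≤ j → j ≤ 2 * q + 1 →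
      ((lam j - s ≤ μd (a j) ∧ μd (1 + a j) ≤ lam j - s) ↔
        (l' j - l (a j) ≤ T ∧ T ≤ l' j - l (1 + a j) - 2)) := by
    intro j h1 h2
    obtain ⟨b1, b2, b3, b4⟩ := ha j h1 h2
    have c1 := hlam' j h1 h2
    have c2 := hμd' (a j) (by omega) (by omega)
    have c3 := hμd' (1 + a j) (by omega) (by omega)
    push_cast at c3
    constructor <;> rintro ⟨d1, d2⟩ <;> constructor <;> omega
  have lpp : l (p + 2) = - l p := by
    have := hl2 p hp (by omega)
    rw [show 2 * p + 1 + 1 - p = p + 2 by omega] at this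
    omega
  have lppos : 0 < l p := by rw [← l0]; exact hl1 p hp (by omega)
  have ineq2 : (lam (q + 1) - s ≤ μd p ∧ μd (p + 2) - 1 ≤ lam (q + 1) - s) ↔
      (- l p ≤ T ∧ T ≤ l p - 2) := by
    have c1 := hlam' (q + 1) (by omega) (by omega)
    have c2 := hμd' p (by omega) (by omega)
    have c3 := hμd' (p + 2) (by omega) (by omega)
    rw [hmid] at c1
    push_cast at c3
    constructor <;> rintro ⟨d1, d2⟩ <;> constructor <;> omega
  have lqq : 1 ≤ q → l' (q + 2) = - l' q := by
    intro hq
    have := hl2' q hq (by omega)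
    rw [show 2 * q + 1 + 1 - q = q + 2 by omega] at this
    omega
  have lqpos : 1 ≤ q → 0 < l' q := by
    intro hq; rw [← l0']; exact hl1' q hq (by omega)
  have ineq3 : 1 ≤ q → a q = p →
      ((μd (p + 1) + s ≤ lam q ∧ lam (q + 2) ≤ μd (p + 1) + s) ↔
      (- l' q ≤ T ∧ T ≤ l' q - 2)) := by
    intro hq haq
    have c1 := hlam' q (by omega) (by omega)
    have c2 := hlam' (q + 2) (by omega) (by omega)
    have c3 := hμd' (p + 1) (by omega) (by omega)
    have c4 := hmir q (by omega) (by omega) (by omega)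
    have c5 := lqq hq
    rw [show 2 * q + 2 - q = q + 2 by omega] at c4
    push_cast at c3
    constructor <;> rintro ⟨d1, d2⟩ <;> constructor <;> omega
  constructor
  · intro h
    refine ⟨?_, ?_, ?_⟩
    · intro j h1 h2 h3
      obtain ⟨b1, b2, b3, b4⟩ := ha j h1 h2
      rw [ineq1 j h1 h2]
      have d1 := (h (a j) j (by omega) (by omega) h1 h2 (by tauto)).1
      have d2 := (h (1 + a j) j (by omega) (by omega) h1 h2 (by tauto)).2
      rw [abs_of_pos (by omega)] at d1
      rw [abs_of_nonpos (by omega)] at d2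
      omega
    · intro _
      rw [ineq2]
      have d1 := h p (q + 1) (by omega) (by omega) (by omega) (by omega) (by omega)
      rw [l0', sub_zero, abs_of_pos lppos] at d1
      exact d1
    · intro hko
      obtain ⟨hq, haq⟩ := hodd hko
      rw [ineq3 hq haq]
      have d1 := h (p + 1) q (by omega) (by omega) (by omega) (by omega) (by omega)
      rw [l0, zero_sub, abs_neg, abs_of_pos (lqpos hq)] at d1
      exact d1
  · rintro ⟨hj, hke, hko⟩
    have hA2 : ∀ i j, 1 ≤ i → i ≤ j → j ≤ 2 * p + 1 → l j ≤ l i := by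
      intro i j h1 h2 h3
      rcases Nat.lt_or_ge i j with h | h
      · exact (hA i j h1 h h3).le
      · have : i = j := by omega
        rw [this]
    have lo : ∀ i j, 1 ≤ i → i ≤ 2 * p + 1 → 1 ≤ j → j ≤ 2 * q + 1 → j ≠ q + 1 →
        l' j < l i → l' j - l i ≤ T := by
      intro i j h1 h2 h3 h4 h5 h6
      have c1 := ((ineq1 j h3 h4).1 (hj j h3 h4 h5)).1
      have c2 := hA2 i (a j) h1 (hpos1 i j h3 h4 h1 h2 h6) (by have := ha j h3 h4; omega)
      omega
    have hi : ∀ i j, 1 ≤ i → i ≤ 2 * p + 1 → 1 ≤ j → j ≤ 2 * q + 1 → j ≠ q + 1 →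
        l i < l' j → T ≤ l' j - l i - 2 := by
      intro i j h1 h2 h3 h4 h5 h6
      have c1 := ((ineq1 j h3 h4).1 (hj j h3 h4 h5)).2
      have c2 := hA2 (1 + a j) i (by omega) (hpos2 i j h3 h4 h1 h2 h6.le) h2
      omega
    have hm : - l p ≤ T ∧ T ≤ l p - 2 := by
      rcases Nat.even_or_odd k with h | h
      · exact ineq2.1 (hke h)
      · obtain ⟨hq, haq⟩ := hodd h
        have c1 := (ineq3 hq haq).1 (hko h)
        have c2 := (ha q hq (by omega)).2.2.1
        rw [haq] at c2
        omega
    intro i j h1 h2 h3 h4 h5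
    by_cases hjq : j = q + 1
    · subst hjq
      rw [l0', sub_zero]
      rcases Nat.lt_or_ge i (p + 1) with h | h
      · have c := hA2 i p h1 (by omega) (by omega)
        rw [abs_of_pos (by omega)]
        omega
      · have c := hA2 (p + 2) i (by omega) (by omega) h2
        rw [abs_of_neg (by omega)]
        omega
    · have c1 := hl2 i h1 h2
      have c2 := hl2' j h3 h4
      have c3 := hdis i j h1 h2 h3 h4 hjq
      rcases lt_or_gt_of_ne c3 with h | h
      · have d1 := hi i j h1 h2 h3 h4 hjq h
        have d2 := lo (2 * p + 1 + 1 - i) (2 * q + 1 + 1 - j) (by omega) (by omega) (by omega)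
          (by omega) (by omega) (by omega)
        rw [abs_of_neg (by omega)]
        omega
      · have d1 := lo i j h1 h2 h3 h4 hjq h
        have d2 := hi (2 * p + 1 + 1 - i) (2 * q + 1 + 1 - j) (by omega) (by omega) (by omega)
          (by omega) (by omega) (by omega)
        rw [abs_of_pos (by omega)]
        omega
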